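/- arXiv:2504.17983 — 3 statements merged into one kernel-verified Lean document; each statement's English description precedes it below -/
import Mathlib

section
/- In the sequential decision framework, the optimal value function is the unique optimal solution of the linear program that minimizes the sum of scores subject to the Bellman inequalities: Φ is itself Bellman-feasible, and for every finite set S of states and every Bellman-feasible f, one has Σ_{s ∈ S} Φ(s) ≤ Σ_{s ∈ S} f(s), with equality if and only if f(s) = Φ(s) for every s ∈ S. -/
open Finset

/-- An *action*: a nonempty finite set of outcome pairs `(p, Δ)` with `p > 0`
for every pair and with the probabilities summing to `1`. -/
def IsAction {n : ℕ} (r : Finset (ℝ × (Fin n → ℤ))) : Prop :=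
  r.Nonempty ∧ (∀ pd ∈ r, 0 < pd.1) ∧ ∑ pd ∈ r, pd.1 = 1

/-- The sequential decision framework: an availability function `R` assigning a
finite set of actions to each state, and a budget `B` that strictly decreases
along every action outcome (so all recursions are well-founded). -/
structure Framework (n : ℕ) where
  R : (Fin n → ℤ) → Finset (Finset (ℝ × (Fin n → ℤ)))
  B : (Fin n → ℤ) → ℕ
  actions_valid : ∀ s, ∀ r ∈ R s, IsAction r
  budget_decr : ∀ s, ∀ r ∈ R s, ∀ pd ∈ r, B (s + pd.2) < B s

/-- `Φ` is the optimal value function for availability `R` and reward `ρ`: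
`Φ s = ρ s` at leaves, and `Φ s = max_{r ∈ R s} Σ_{(p,Δ)∈r} p · Φ (s+Δ)` otherwise. -/
def IsOptValue {n : ℕ} (R : (Fin n → ℤ) → Finset (Finset (ℝ × (Fin n → ℤ))))
    (ρ Φ : (Fin n → ℤ) → ℝ) : Prop :=
  (∀ s, R s = ∅ → Φ s = ρ s) ∧
  (∀ s (h : (R s).Nonempty),
    Φ s = (R s).sup' h (fun r => ∑ pd ∈ r, pd.1 * Φ (s + pd.2)))

/-- `π` is a policy: at every non-leaf state it selects an available action. -/
def IsPolicy {n : ℕ} (R : (Fin n → ℤ) → Finset (Finset (ℝ × (Fin n → ℤ))))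
    (π : (Fin n → ℤ) → Finset (ℝ × (Fin n → ℤ))) : Prop :=
  ∀ s, R s ≠ ∅ → π s ∈ R s

/-- `V` is the value function of policy `π`: `V s = ρ s` at leaves, and
`V s = Σ_{(p,Δ)∈π(s)} p · V (s+Δ)` otherwise. -/
def IsPolicyValue {n : ℕ} (R : (Fin n → ℤ) → Finset (Finset (ℝ × (Fin n → ℤ))))
    (ρ : (Fin n → ℤ) → ℝ) (π : (Fin n → ℤ) → Finset (ℝ × (Fin n → ℤ)))
    (V : (Fin n → ℤ) → ℝ) : Prop :=
  (∀ s, R s = ∅ → V s = ρ s) ∧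
  (∀ s, R s ≠ ∅ → V s = ∑ pd ∈ π s, pd.1 * V (s + pd.2))

/-- `f` is Bellman-feasible: `f s = ρ s` at every leaf, and
`Σ_{(p,Δ)∈r} p · f (s+Δ) ≤ f s` for every non-leaf state `s` and every `r ∈ R s`. -/
def IsBellmanFeasible {n : ℕ} (R : (Fin n → ℤ) → Finset (Finset (ℝ × (Fin n → ℤ))))
    (ρ f : (Fin n → ℤ) → ℝ) : Prop :=
  (∀ s, R s = ∅ → f s = ρ s) ∧
  (∀ s, R s ≠ ∅ → ∀ r ∈ R s, ∑ pd ∈ r, pd.1 * f (s + pd.2) ≤ f s)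

theorem IsOptValue.isBellmanFeasible {n : ℕ}
    {R : (Fin n → ℤ) → Finset (Finset (ℝ × (Fin n → ℤ)))} {ρ Φ : (Fin n → ℤ) → ℝ}
    (hΦ : IsOptValue R ρ Φ) : IsBellmanFeasible R ρ Φ := by
  refine ⟨hΦ.1, fun s hs r hr => ?_⟩
  rw [hΦ.2 s (Finset.nonempty_iff_ne_empty.mpr hs)]
  exact Finset.le_sup' (fun r => ∑ pd ∈ r, pd.1 * Φ (s + pd.2)) hr

/-- The optimal value function is a pointwise lower bound for every Bellman-feasible function. -/
theorem IsOptValue.le_of_isBellmanFeasible {n : ℕ} (F : Framework n)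
    {ρ Φ f : (Fin n → ℤ) → ℝ} (hΦ : IsOptValue F.R ρ Φ) (hf : IsBellmanFeasible F.R ρ f)
    (s : Fin n → ℤ) : Φ s ≤ f s := by
  induction s using (measure F.B).wf.induction with
  | _ s ih =>
    by_cases hs : F.R s = ∅
    · exact (hΦ.1 s hs).trans_le (hf.1 s hs).ge
    · rw [hΦ.2 s (Finset.nonempty_iff_ne_empty.mpr hs)]
      refine Finset.sup'_le _ _ fun r hr => le_trans ?_ (hf.2 s hs r hr)
      exact Finset.sum_le_sum fun pd hpd => mul_le_mul_of_nonneg_left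
        (ih _ (F.budget_decr s r hr pd hpd)) ((F.actions_valid s r hr).2.1 pd hpd).le

/-- The optimal value function is the unique optimal solution of the linear
program minimizing the sum of scores subject to the Bellman inequalities:
`Φ` is itself Bellman-feasible, and for every finite set `S` of states and every
Bellman-feasible `f` we have `Σ_{s∈S} Φ s ≤ Σ_{s∈S} f s`, with equality
if and only if `f s = Φ s` for every `s ∈ S`. -/
theorem optimal_value_unique_LP_solution {n : ℕ} (F : Framework n)
    (ρ Φ : (Fin n → ℤ) → ℝ) (hΦ : IsOptValue F.R ρ Φ) :
    IsBellmanFeasible F.R ρ Φ ∧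
    ∀ (S : Finset (Fin n → ℤ)) (f : (Fin n → ℤ) → ℝ), IsBellmanFeasible F.R ρ f →
      (∑ s ∈ S, Φ s ≤ ∑ s ∈ S, f s) ∧
      ((∑ s ∈ S, Φ s = ∑ s ∈ S, f s) ↔ ∀ s ∈ S, f s = Φ s) := by
  refine ⟨hΦ.isBellmanFeasible, fun S f hf => ?_⟩
  have hle : ∀ s ∈ S, Φ s ≤ f s := fun s _ => hΦ.le_of_isBellmanFeasible F hf s
  refine ⟨Finset.sum_le_sum hle, (Finset.sum_eq_sum_iff_of_le hle).trans ?_⟩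
  simp only [eq_comm]
end

section
/- Pruning correctness: in the sequential decision framework, let R̲ be a second availability function with R̲(s) ⊆ R(s) for every state s (with the same budget B and reward ρ), and let Φ̲ denote the optimal value function for the pruned problem (R̲, B, ρ). Suppose that for every state s: (a) if R̲(s) = ∅ and R(s) ≠ ∅ then Φ(s) = ρ(s), and (b) if R̲(s) ≠ ∅ then there exists r ∈ R̲(s) with Σ_{(p,Δ)∈r} p · Φ(s + Δ) = Φ(s). Then Φ̲(s) = Φ(s) for every state s; that is, the pruning has zero impact on the score of the optimal decision tree. -/
open Finset

/-- Pruning correctness: let `R'` be a pruned availability function with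
`R' s ⊆ F.R s` for every state (same budget and reward).  If (a) whenever
`R'` makes `s` a leaf but `R` does not, `Φ s = ρ s`, and (b) whenever
`R' s ≠ ∅` some action of `R' s` attains the Bellman maximum for `Φ`, then the
optimal value function `Φ'` of the pruned problem equals `Φ` at every state:
the pruning has zero impact on the score of the optimal decision tree. -/
theorem pruning_preserves_optimal_value {n : ℕ} (F : Framework n)
    (ρ Φ : (Fin n → ℤ) → ℝ) (hΦ : IsOptValue F.R ρ Φ)
    (R' : (Fin n → ℤ) → Finset (Finset (ℝ × (Fin n → ℤ))))
    (hsub : ∀ s, R' s ⊆ F.R s)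
    (ha : ∀ s, R' s = ∅ → F.R s ≠ ∅ → Φ s = ρ s)
    (hb : ∀ s, R' s ≠ ∅ → ∃ r ∈ R' s, ∑ pd ∈ r, pd.1 * Φ (s + pd.2) = Φ s)
    (Φ' : (Fin n → ℤ) → ℝ) (hΦ' : IsOptValue R' ρ Φ') :
    ∀ s, Φ' s = Φ s := by
  intro s
  induction hk : F.B s using Nat.strong_induction_on generalizing s with
  | _ k ih =>
  subst hk
  rcases (R' s).eq_empty_or_nonempty with h | h
  · rw [hΦ'.1 s h]
    by_cases hR : F.R s = ∅
    · exact (hΦ.1 s hR).symm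
    · exact (ha s h hR).symm
  · have hsum : ∀ r ∈ R' s,
        ∑ pd ∈ r, pd.1 * Φ' (s + pd.2) = ∑ pd ∈ r, pd.1 * Φ (s + pd.2) := fun r hr =>
      sum_congr rfl fun pd hpd => by
        rw [ih _ (F.budget_decr s r (hsub s hr) pd hpd) _ rfl]
    rw [hΦ'.2 s h, sup'_congr h rfl hsum]
    apply le_antisymm
    · rw [hΦ.2 s (h.mono (hsub s))]
      exact sup'_mono _ (hsub s) h
    · obtain ⟨r, hr, hrΦ⟩ := hb s h.ne_empty
      exact hrΦ.ge.trans (le_sup' (fun r => ∑ pd ∈ r, pd.1 * Φ (s + pd.2)) hr)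
end

section
/- Reduced-graph correctness: in the sequential decision framework, define the best-action set R*(s) = {r ∈ R(s) : Σ_{(p,Δ)∈r} p · Φ(s + Δ) = Φ(s)}. Then R*(s) ≠ ∅ whenever R(s) ≠ ∅, and the optimal value function of the decision problem with availability function R* (and the same budget B and reward ρ) equals Φ at every state. -/
open Finset

open scoped Classical in
/-- The best-action availability function: `R* s` consists of the actions of
`R s` attaining the Bellman maximum `Φ s`. -/
noncomputable def bestActions {n : ℕ}
    (R : (Fin n → ℤ) → Finset (Finset (ℝ × (Fin n → ℤ))))
    (Φ : (Fin n → ℤ) → ℝ) : (Fin n → ℤ) → Finset (Finset (ℝ × (Fin n → ℤ))) :=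
  fun s => (R s).filter (fun r => ∑ pd ∈ r, pd.1 * Φ (s + pd.2) = Φ s)

theorem mem_bestActions {n : ℕ} {R : (Fin n → ℤ) → Finset (Finset (ℝ × (Fin n → ℤ)))}
    {Φ : (Fin n → ℤ) → ℝ} {s : Fin n → ℤ} {r : Finset (ℝ × (Fin n → ℤ))} :
    r ∈ bestActions R Φ s ↔ r ∈ R s ∧ ∑ pd ∈ r, pd.1 * Φ (s + pd.2) = Φ s := by
  simp [bestActions]

theorem IsOptValue.bestActions_nonempty {n : ℕ}
    {R : (Fin n → ℤ) → Finset (Finset (ℝ × (Fin n → ℤ)))} {ρ Φ : (Fin n → ℤ) → ℝ}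
    (hΦ : IsOptValue R ρ Φ) {s : Fin n → ℤ} (hs : (R s).Nonempty) :
    (bestActions R Φ s).Nonempty := by
  obtain ⟨r, hr, hmax⟩ :=
    Finset.exists_mem_eq_sup' hs (fun r => ∑ pd ∈ r, pd.1 * Φ (s + pd.2))
  exact ⟨r, mem_bestActions.2 ⟨hr, ((hΦ.2 s hs).trans hmax).symm⟩⟩

/-- Reduced-graph correctness: the best-action set `R* s` is nonempty whenever
`R s` is, and the optimal value function of the decision problem with
availability `R*` (same budget and reward) equals `Φ` at every state. -/
theorem reduced_graph_correct {n : ℕ} (F : Framework n)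
    (ρ Φ : (Fin n → ℤ) → ℝ) (hΦ : IsOptValue F.R ρ Φ) :
    (∀ s, F.R s ≠ ∅ → bestActions F.R Φ s ≠ ∅) ∧
    (∀ Ψ : (Fin n → ℤ) → ℝ, IsOptValue (bestActions F.R Φ) ρ Ψ → ∀ s, Ψ s = Φ s) := by
  refine ⟨fun s hs => (hΦ.bestActions_nonempty (nonempty_iff_ne_empty.2 hs)).ne_empty,
    fun Ψ hΨ s => ?_⟩
  induction hB : F.B s using Nat.strong_induction_on generalizing s with
  | _ b ih =>
    subst hB
    rcases (F.R s).eq_empty_or_nonempty with hs | hs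
    · have hs' : bestActions F.R Φ s = ∅ := by simp [bestActions, hs]
      rw [hΨ.1 s hs', hΦ.1 s hs]
    · have hs' := hΦ.bestActions_nonempty hs
      rw [hΨ.2 s hs']
      obtain ⟨r, hr, hmax⟩ :=
        Finset.exists_mem_eq_sup' hs' (fun r => ∑ pd ∈ r, pd.1 * Ψ (s + pd.2))
      obtain ⟨hrR, hrΦ⟩ := mem_bestActions.1 hr
      rw [hmax, ← hrΦ]
      exact Finset.sum_congr rfl fun pd hpd => by
        rw [ih _ (F.budget_decr s r hrR pd hpd) _ rfl]
end
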